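/- The supremum of the ratio |♥(K)| / |K| over all triangles K ⊂ ℝ² (nondegenerate compact triangles, i.e. convex hulls of three affinely independent points) equals 3/8; moreover, the supremum is not attained: for every triangle K one has |♥(K)| < (3/8) |K|. -/

import Mathlib

open MeasureTheory Set Metric
open scoped RealInnerProductSpace ENNReal NNReal

noncomputable section

/-- Reflection of `x` across the hyperplane `{z : ⟪z, ω⟫ = l}` (for a unit vector `ω`). -/
def reflectH {N : ℕ} (l : ℝ) (ω x : EuclideanSpace ℝ (Fin N)) : EuclideanSpace ℝ (Fin N) :=
  x + (2 * (l - ⟪x, ω⟫)) • ω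

/-- The maximal folding function of a set `K`:
`R_K(ω) = inf {l : the reflection of K ∩ {⟪·,ω⟫ ≥ l} across {⟪·,ω⟫ = l} lies in K}`. -/
def foldingFn {N : ℕ} (K : Set (EuclideanSpace ℝ (Fin N))) (ω : EuclideanSpace ℝ (Fin N)) : ℝ :=
  sInf {l : ℝ | reflectH l ω '' {x ∈ K | l ≤ ⟪x, ω⟫} ⊆ K}

/-- The heart of a set `K`. -/
def heart {N : ℕ} (K : Set (EuclideanSpace ℝ (Fin N))) : Set (EuclideanSpace ℝ (Fin N)) :=
  {x ∈ K | ∀ ω : EuclideanSpace ℝ (Fin N), ‖ω‖ = 1 → ⟪x, ω⟫ ≤ foldingFn K ω}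

/-- Area of a closed region between two continuous graphs. -/
lemma volume_region_Icc {f g : ℝ → ℝ} (hf : Continuous f) (hg : Continuous g) {a b : ℝ}
    (hab : a ≤ b) (hfg : ∀ x ∈ Icc a b, f x ≤ g x) :
    volume {p : ℝ × ℝ | p.1 ∈ Icc a b ∧ p.2 ∈ Icc (f p.1) (g p.1)} =
      ENNReal.ofReal (∫ x in a..b, (g x - f x)) := by
  have hm : MeasurableSet {p : ℝ × ℝ | p.1 ∈ Icc a b ∧ p.2 ∈ Icc (f p.1) (g p.1)} := by
    apply IsClosed.measurableSet
    exact ((isClosed_le continuous_const continuous_fst).inter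
      (isClosed_le continuous_fst continuous_const)).inter
      ((isClosed_le (hf.comp continuous_fst) continuous_snd).inter
      (isClosed_le continuous_snd (hg.comp continuous_fst)))
  rw [Measure.volume_eq_prod, Measure.prod_apply hm, intervalIntegral.integral_of_le hab,
    ← integral_Icc_eq_integral_Ioc, ofReal_integral_eq_lintegral_ofReal,
    ← lintegral_indicator measurableSet_Icc]
  · refine lintegral_congr fun x => ?_
    by_cases hx : x ∈ Icc a b
    · rw [indicator_of_mem hx, ← Real.volume_Icc]
      congr 1
      ext y
      simp only [mem_preimage, mem_ofPred_eq, hx, true_and]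
    · rw [indicator_of_notMem hx]
      convert measure_empty (μ := (volume : Measure ℝ))
      ext y
      simp only [mem_preimage, mem_ofPred_eq, hx, false_and, mem_empty_iff_false]
  · exact (hg.sub hf).continuousOn.integrableOn_Icc
  · refine (ae_restrict_iff' measurableSet_Icc).2 (Filter.Eventually.of_forall fun x hx => ?_)
    simpa using hfg x hx

/-- Area of a closed region between two continuous graphs over the second coordinate. -/
lemma volume_region_Icc_swap {f g : ℝ → ℝ} (hf : Continuous f) (hg : Continuous g) {a b : ℝ}
    (hab : a ≤ b) (hfg : ∀ x ∈ Icc a b, f x ≤ g x) :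
    volume {p : ℝ × ℝ | p.2 ∈ Icc a b ∧ p.1 ∈ Icc (f p.2) (g p.2)} =
      ENNReal.ofReal (∫ x in a..b, (g x - f x)) := by
  rw [← volume_region_Icc hf hg hab hfg]
  exact (Measure.measurePreserving_swap (μ := (volume : Measure ℝ))
    (ν := (volume : Measure ℝ))).measure_preimage_emb MeasurableEquiv.prodComm.measurableEmbedding
      {p : ℝ × ℝ | p.1 ∈ Icc a b ∧ p.2 ∈ Icc (f p.1) (g p.1)}

/-- The image of a planar set under an affine isomorphism `p ↦ A + L p` has its area multiplied by
a fixed positive constant. -/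
lemma exists_volume_image_affine (A : EuclideanSpace ℝ (Fin 2))
    (L : ℝ × ℝ →ₗ[ℝ] EuclideanSpace ℝ (Fin 2)) (hL : Function.Injective L) :
    ∃ D : ℝ≥0∞, D ≠ 0 ∧ D ≠ ⊤ ∧
      ∀ S : Set (ℝ × ℝ), volume ((fun p => A + L p) '' S) = D * volume S := by
  have hfin : Module.finrank ℝ (ℝ × ℝ) = Module.finrank ℝ (EuclideanSpace ℝ (Fin 2)) := by
    simp
  let e := (LinearEquiv.ofInjectiveOfFinrankEq L hL hfin).toContinuousLinearEquiv
  let μ : Measure (ℝ × ℝ) := Measure.map e.symm (volume : Measure (EuclideanSpace ℝ (Fin 2)))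
  have : μ.IsAddHaarMeasure := e.symm.isAddHaarMeasure_map volume
  have hμ := Measure.isAddLeftInvariant_eq_smul μ (volume : Measure (ℝ × ℝ))
  refine ⟨Measure.addHaarScalarFactor μ volume, ?_, ENNReal.coe_ne_top, fun S => ?_⟩
  · exact_mod_cast (Measure.addHaarScalarFactor_pos_of_isAddHaarMeasure μ volume).ne'
  · have h1 : (fun p => A + L p) '' S = (fun x => A + x) '' (e '' S) := by
      rw [image_image]; rfl
    have h2 : e '' S = e.symm ⁻¹' S := e.image_eq_preimage_symm S
    rw [h1, image_add_left, measure_preimage_add, h2]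
    have h3 : μ S = volume (e.symm ⁻¹' S) :=
      e.symm.toHomeomorph.toMeasurableEquiv.map_apply S
    rw [← h3]
    exact congrArg (fun m : Measure (ℝ × ℝ) => m S) hμ

lemma bddBelow_fold {N : ℕ} {K : Set (EuclideanSpace ℝ (Fin N))} (hK : Bornology.IsBounded K)
    (hne : K.Nonempty) {ω : EuclideanSpace ℝ (Fin N)} (hω : ‖ω‖ = 1) :
    BddBelow {l : ℝ | reflectH l ω '' {x ∈ K | l ≤ ⟪x, ω⟫} ⊆ K} := by
  obtain ⟨M, hM⟩ := hK.exists_norm_le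
  have hin : ∀ x ∈ K, -M ≤ ⟪x, ω⟫ := fun x hx => by
    have := abs_real_inner_le_norm x ω
    rw [hω, mul_one] at this
    linarith [neg_abs_le ⟪x, ω⟫, hM x hx]
  obtain ⟨x, hx⟩ := hne
  refine ⟨-M, fun l hl => ?_⟩
  by_contra! hlt
  have h1 := hin x hx
  have h2 := hin _ (hl ⟨x, ⟨hx, by linarith⟩, rfl⟩)
  rw [reflectH, inner_add_left, real_inner_smul_left, real_inner_self_eq_norm_sq, hω] at h2
  linarith

lemma nonempty_fold {N : ℕ} {K : Set (EuclideanSpace ℝ (Fin N))} (hK : Bornology.IsBounded K)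
    {ω : EuclideanSpace ℝ (Fin N)} (hω : ‖ω‖ = 1) :
    {l : ℝ | reflectH l ω '' {x ∈ K | l ≤ ⟪x, ω⟫} ⊆ K}.Nonempty := by
  obtain ⟨M, hM⟩ := hK.exists_norm_le
  refine ⟨M + 1, ?_⟩
  rintro _ ⟨x, ⟨hx, hl⟩, rfl⟩
  have := abs_real_inner_le_norm x ω
  rw [hω, mul_one] at this
  linarith [le_abs_self ⟪x, ω⟫, hM x hx]

/-- If the part of `K` on the positive side of the line through `Z` with normal `w` can be folded
into `K`, then the heart lies on the other side. -/
lemma inner_sub_nonpos_of_mem_heart {N : ℕ} {K : Set (EuclideanSpace ℝ (Fin N))}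
    (hK : Bornology.IsBounded K) {P : EuclideanSpace ℝ (Fin N)} (hP : P ∈ heart K)
    {Z w : EuclideanSpace ℝ (Fin N)} (hw : w ≠ 0)
    (h : ∀ x ∈ K, 0 ≤ ⟪x - Z, w⟫ → x - (2 * ⟪x - Z, w⟫ / ⟪w, w⟫) • w ∈ K) :
    ⟪P - Z, w⟫ ≤ 0 := by
  have hn : 0 < ‖w‖ := norm_pos_iff.2 hw
  have hω : ‖(‖w‖⁻¹ • w)‖ = 1 := norm_smul_inv_norm (𝕜 := ℝ) hw
  have hle := hP.2 _ hω
  have hi : ∀ x : EuclideanSpace ℝ (Fin N), ⟪x, ‖w‖⁻¹ • w⟫ - ⟪Z, ‖w‖⁻¹ • w⟫ =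
      ‖w‖⁻¹ * ⟪x - Z, w⟫ := fun x => by
    rw [← inner_sub_left, real_inner_smul_right]
  have hf : foldingFn K (‖w‖⁻¹ • w) ≤ ⟪Z, ‖w‖⁻¹ • w⟫ := by
    refine csInf_le (bddBelow_fold hK ⟨P, hP.1⟩ hω) ?_
    rintro _ ⟨x, ⟨hx, hl⟩, rfl⟩
    have h0 : 0 ≤ ⟪x - Z, w⟫ := by
      have := hi x
      by_contra! hneg
      have := mul_neg_of_pos_of_neg (inv_pos.2 hn) hneg
      linarith
    convert h x hx h0 using 1
    rw [reflectH, sub_eq_add_neg x, ← neg_smul, smul_smul, real_inner_self_eq_norm_sq]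
    congr 2
    have h3 : ⟪Z, ‖w‖⁻¹ • w⟫ - ⟪x, ‖w‖⁻¹ • w⟫ = - (‖w‖⁻¹ * ⟪x - Z, w⟫) := by rw [← hi x]; ring
    rw [h3]
    field_simp
  have h4 := hi P
  by_contra! hpos
  have := mul_pos (inv_pos.2 hn) hpos
  linarith

lemma mem_heart_of_forall {N : ℕ} {K : Set (EuclideanSpace ℝ (Fin N))}
    (hK : Bornology.IsBounded K) {P : EuclideanSpace ℝ (Fin N)} (hP : P ∈ K)
    (h : ∀ ω : EuclideanSpace ℝ (Fin N), ‖ω‖ = 1 → ∀ l < ⟪P, ω⟫,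
      ¬ ∀ x ∈ K, l ≤ ⟪x, ω⟫ → reflectH l ω x ∈ K) :
    P ∈ heart K := by
  refine ⟨hP, fun ω hω => le_csInf (nonempty_fold hK hω) fun l hl => ?_⟩
  by_contra! hlt
  exact h ω hω l hlt fun x hx hlx => hl ⟨x, ⟨hx, hlx⟩, rfl⟩

/-- The coordinate description of the triangle with vertices `(0, 0)`, `(b, h)`, `(1, 0)`. -/
def MemTriangle (b h x y : ℝ) : Prop :=
  0 ≤ y ∧ b * y ≤ h * x ∧ (1 - b) * y ≤ h * (1 - x)

/-- In a flat triangle, a fold along a line leaving a point of a suitable trapezoid strictly on the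
folded side never maps the folded part into the triangle. -/
lemma not_fold_memTriangle {b h x y c s l : ℝ} (hb : 0 < b) (hb' : b ≤ 1 / 10) (hh : 0 < h)
    (hhb : h ≤ b ^ 2) (hx : 2 * b ≤ x) (hx' : x ≤ 1 / 2) (hy : 0 ≤ y)
    (hy' : 2 * y ≤ h * (1 - b) * (1 - x)) (hcs : c ^ 2 + s ^ 2 = 1) (hl : l < x * c + y * s)
    (H : ∀ p q, MemTriangle b h p q → l ≤ p * c + q * s →
      MemTriangle b h (p + 2 * (l - (p * c + q * s)) * c) (q + 2 * (l - (p * c + q * s)) * s)) :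
    False := by
  have hA := H 0 0 ⟨by simp, by simp, by simpa using hh.le⟩
  have hB := H b h ⟨hh.le, by linarith [mul_comm b h], by linarith [mul_comm (1 - b) h]⟩
  have hC := H 1 0 ⟨by simp, by simpa using hh.le, by simp⟩
  simp only [MemTriangle, zero_mul, one_mul, add_zero, zero_add, sub_zero] at hA hB hC
  have hh1 : h ≤ b / 10 := by nlinarith
  have hyh : 2 * y ≤ h * (1 - b) := by
    have : 0 ≤ h * (1 - b) * x :=
      mul_nonneg (mul_nonneg hh.le (by linarith)) (by linarith)
    linarith
  have hyh' : 2 * y ≤ h := by nlinarith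
  rcases lt_trichotomy s 0 with hs | hs | hs
  · obtain ⟨σ, rfl⟩ : ∃ σ, s = -σ := ⟨-s, by ring⟩
    have hσ : 0 < σ := by linarith
    rcases le_or_gt 0 c with hc | hc
    · obtain ⟨d, hd⟩ : ∃ d, d = 2 * (c - l) := ⟨_, rfl⟩
      have hyσ : 0 ≤ y * σ := by positivity
      have hxc : c ≤ 2 * ((1 - x) * c) := by nlinarith
      have hdc : c < d := by nlinarith
      have hd0 : 0 < d := by linarith
      obtain ⟨-, h2, h3⟩ := hC (by linarith)
      have h4 : (1 - b) * σ ≤ h * c := by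
        refine le_of_mul_le_mul_left ?_ hd0
        subst hd
        linarith
      have h5 : d * (b * σ + h * c) ≤ h := by subst hd; linarith
      have h6 : c * (b * σ + h * c) ≤ h := by
        refine le_trans (mul_le_mul_of_nonneg_right hdc.le ?_) h5
        positivity
      have h7 : b * c ≤ h * σ := by
        refine le_of_mul_le_mul_left ?_ hσ
        have : h = h * (c ^ 2 + (-σ) ^ 2) := by rw [hcs, mul_one]
        linarith
      have h8 : σ ≤ 2 * h * c := by nlinarith
      have hc0 : 0 < c := by
        by_contra! hc'
        nlinarith
      nlinarith [mul_pos hb hc0, mul_pos hh hc0, mul_le_mul_of_nonneg_left h8 hh.le]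
    · obtain ⟨κ, rfl⟩ : ∃ κ, c = -κ := ⟨-c, by ring⟩
      have hκ : 0 < κ := by linarith
      have hyσ : 0 ≤ y * σ := by positivity
      have hxκ : 2 * b * κ ≤ x * κ := mul_le_mul_of_nonneg_right hx hκ.le
      have hbκ : 0 < b * κ := by positivity
      have hl0 : 0 < -(2 * l) := by linarith
      obtain ⟨-, h2, -⟩ := hA (by linarith)
      have h4 : b * σ ≤ h * κ := by
        refine le_of_mul_le_mul_left ?_ hl0
        linarith
      have h5 : h * σ ≤ b * κ := by
        have h51 : h * (b * σ) ≤ h * (h * κ) := mul_le_mul_of_nonneg_left h4 hh.le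
        have h52 : h * h ≤ b * b := by nlinarith
        have h53 : h * h * κ ≤ b * b * κ := mul_le_mul_of_nonneg_right h52 hκ.le
        refine le_of_mul_le_mul_left ?_ hb
        linarith
      have hm : l < b * -κ + h * -σ := by linarith
      obtain ⟨-, h6, h7⟩ := hB hm.le
      have h8 := mul_pos (sub_pos.2 hm) hσ
      nlinarith
  · subst hs
    have hc : (c - 1) * (c + 1) = 0 := by linarith
    rcases mul_eq_zero.1 hc with hc | hc
    · obtain rfl : c = 1 := by linarith
      obtain ⟨-, h2, -⟩ := hC (by linarith)
      nlinarith
    · obtain rfl : c = -1 := by linarith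
      obtain ⟨-, -, h3⟩ := hB (by linarith)
      nlinarith
  · have hl0 : 0 ≤ l := by
      by_contra! hneg
      have := (hA hneg.le).1
      nlinarith [mul_pos_of_neg_of_neg hneg (neg_lt_zero.2 hs)]
    have hcl : c ≤ l := by
      by_contra! hneg
      have := (hC hneg.le).1
      nlinarith [mul_pos (sub_pos.2 hneg) hs]
    have hys : 0 ≤ y * s := by positivity
    have hhs : 0 < h * s := by positivity
    have hyhs : 2 * (y * s) ≤ h * s := by
      have := mul_le_mul_of_nonneg_right hyh' hs.le
      linarith
    suffices hmain : l ≤ b * c + h * s ∧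
        h * c ^ 2 + 2 * (x - b) * c * s ≤ (h - 2 * y) * s ^ 2 by
      have h1 := (hB hmain.1).1
      have h2 := mul_pos (sub_pos.2 hl) hs
      have h3 : h = h * (c ^ 2 + s ^ 2) := by rw [hcs, mul_one]
      nlinarith [hmain.2]
    rcases le_or_gt c 0 with hc | hc
    · have h1 : 0 ≤ (x - b) * -c := mul_nonneg (by linarith) (by linarith)
      refine ⟨by linarith, ?_⟩
      have h2 : 2 * b * -c ≤ x * -c := mul_le_mul_of_nonneg_right hx (by linarith)
      have h3 : b * -c ≤ b * (b * s) := by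
        have : h * s ≤ b ^ 2 * s := mul_le_mul_of_nonneg_right hhb hs.le
        nlinarith
      have h4 : -c ≤ b * s := le_of_mul_le_mul_left h3 hb
      have h5 : c ^ 2 ≤ b * s ^ 2 := by nlinarith [mul_pos hb hs, sq_nonneg s]
      have h6 : h * c ^ 2 ≤ h * (b * s ^ 2) := mul_le_mul_of_nonneg_left h5 hh.le
      have h7 : h * b * s ^ 2 ≤ (h - 2 * y) * s ^ 2 :=
        mul_le_mul_of_nonneg_right (by linarith) (sq_nonneg s)
      have h8 : 0 ≤ (x - b) * -c * s := mul_nonneg h1 hs.le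
      linarith
    · have h1 : (1 - x) * c ≤ y * s := by linarith
      have h2 : (x - b) * c ≤ (1 - x) * c := mul_le_mul_of_nonneg_right (by linarith) hc.le
      refine ⟨by linarith, ?_⟩
      have h3 : c ≤ h * s := by
        have : 1 / 2 * c ≤ (1 - x) * c := mul_le_mul_of_nonneg_right (by linarith) hc.le
        linarith
      have hx1 : 0 < 1 - x := by linarith
      have h4 : c ^ 2 ≤ b * s ^ 2 := by
        have h41 : h * s ≤ b / 10 * s := mul_le_mul_of_nonneg_right hh1 hs.le
        have h42 : c ≤ b * s := by linarith [mul_pos hb hs]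
        calc c ^ 2 ≤ (b * s) ^ 2 := by gcongr
          _ = b * (b * s ^ 2) := by ring
          _ ≤ 1 * (b * s ^ 2) := by gcongr; linarith
          _ = b * s ^ 2 := one_mul _
      refine le_of_mul_le_mul_left ?_ hx1
      have h5 : 2 * ((x - b) * s) * ((1 - x) * c) ≤ 2 * ((x - b) * s) * (y * s) :=
        mul_le_mul_of_nonneg_left h1
          (mul_nonneg zero_le_two (mul_nonneg (by linarith) hs.le))
      have h6 : (1 - x) * h * c ^ 2 ≤ (1 - x) * h * (b * s ^ 2) :=
        mul_le_mul_of_nonneg_left h4 (by positivity)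
      have h7 : (1 - b) * (2 * y) ≤ (1 - b) * (h * (1 - b) * (1 - x)) :=
        mul_le_mul_of_nonneg_left hy' (by linarith)
      have h8 : 0 ≤ h * (1 - x) * (b - b ^ 2) :=
        mul_nonneg (by positivity) (by nlinarith)
      have h9 : 0 ≤ ((1 - x) * (h - 2 * y) - 2 * (x - b) * y - (1 - x) * h * b) * s ^ 2 :=
        mul_nonneg (by linarith) (sq_nonneg s)
      linarith

lemma integral_of_forall_eq_affine {F : ℝ → ℝ} {m k a b : ℝ} (hF : ∀ x, F x = m + k * x) :
    ∫ x in a..b, F x = m * (b - a) + k * (b ^ 2 - a ^ 2) / 2 := by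
  simp only [hF]
  rw [intervalIntegral.integral_add (by simp) (Continuous.intervalIntegrable (by fun_prop) _ _),
    intervalIntegral.integral_const, intervalIntegral.integral_const_mul, integral_id, smul_eq_mul]
  ring

/-- The linear map `(β, γ) ↦ β u + γ v`. -/
def combMap {E : Type*} [AddCommGroup E] [Module ℝ E] (u v : E) : ℝ × ℝ →ₗ[ℝ] E :=
  (LinearMap.fst ℝ ℝ ℝ).smulRight u + (LinearMap.snd ℝ ℝ ℝ).smulRight v

lemma combMap_apply {E : Type*} [AddCommGroup E] [Module ℝ E] (u v : E) (p : ℝ × ℝ) :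
    combMap u v p = p.1 • u + p.2 • v := rfl

/-- The standard triangle. -/
def stdTriangle : Set (ℝ × ℝ) := {p | p.1 ∈ Icc (0 : ℝ) 1 ∧ p.2 ∈ Icc 0 (1 - p.1)}

lemma volume_stdTriangle : volume stdTriangle = ENNReal.ofReal (1 / 2) := by
  rw [stdTriangle, volume_region_Icc (f := fun _ => 0) (g := fun x => 1 - x) (by fun_prop)
    (by fun_prop) zero_le_one (fun x hx => by simpa using hx.2)]
  rw [integral_of_forall_eq_affine (m := 1) (k := -1) fun x => by ring]
  norm_num

lemma convexHull_triple_eq_image {E : Type*} [AddCommGroup E] [Module ℝ E] (A B C : E) :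
    convexHull ℝ {A, B, C} = (fun p => A + combMap (B - A) (C - A) p) '' stdTriangle := by
  apply Subset.antisymm
  · refine convexHull_min ?_ ?_
    · rintro x (rfl | rfl | rfl)
      · exact ⟨(0, 0), by simp [stdTriangle], by simp [combMap_apply]⟩
      · exact ⟨(1, 0), by simp [stdTriangle], by simp [combMap_apply]⟩
      · exact ⟨(0, 1), by simp [stdTriangle], by simp [combMap_apply]⟩
    · have hc : Convex ℝ stdTriangle := by
        rintro ⟨x, y⟩ ⟨⟨h1, -⟩, h2, h3⟩ ⟨x', y'⟩ ⟨⟨h1', -⟩, h2', h3'⟩ s t hs ht hst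
        simp only at h1 h2 h3 h1' h2' h3'
        have e1 := mul_nonneg hs h1
        have e2 := mul_nonneg hs h2
        have e3 := mul_nonneg ht h1'
        have e4 := mul_nonneg ht h2'
        have e5 := mul_le_mul_of_nonneg_left h3 hs
        have e6 := mul_le_mul_of_nonneg_left h3' ht
        simp only [stdTriangle, mem_ofPred_eq, Prod.smul_mk, Prod.mk_add_mk, smul_eq_mul, mem_Icc]
        exact ⟨⟨by linarith, by linarith⟩, by linarith, by linarith⟩
      have := (hc.linear_image (combMap (B - A) (C - A))).translate A
      rwa [image_image] at this
  · rintro _ ⟨⟨β, γ⟩, ⟨⟨h1, -⟩, h2, h3⟩, rfl⟩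
    simp only at h1 h2 h3
    have := (convex_convexHull ℝ {A, B, C}).sum_mem (t := Finset.univ)
      (w := ![1 - β - γ, β, γ]) (z := ![A, B, C])
      (by intro i _; fin_cases i <;> simp <;> linarith)
      (by simp only [Fin.sum_univ_three, Matrix.cons_val]; ring)
      (by intro i _; fin_cases i <;> exact subset_convexHull ℝ _ (by simp))
    convert this using 1
    simp only [combMap_apply, Fin.sum_univ_three, Matrix.cons_val]
    module

lemma mem_convexHull_triple {E : Type*} [AddCommGroup E] [Module ℝ E] {A B C x : E} :
    x ∈ convexHull ℝ {A, B, C} ↔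
      ∃ β γ : ℝ, 0 ≤ β ∧ 0 ≤ γ ∧ β + γ ≤ 1 ∧ A + (β • (B - A) + γ • (C - A)) = x := by
  rw [convexHull_triple_eq_image]
  constructor
  · rintro ⟨⟨β, γ⟩, ⟨⟨h1, -⟩, h2, h3⟩, rfl⟩
    exact ⟨β, γ, h1, h2, by simp only at h3; linarith, rfl⟩
  · rintro ⟨β, γ, h1, h2, h3, rfl⟩
    exact ⟨(β, γ), ⟨⟨h1, by simp only; linarith⟩, h2, by simp only; linarith⟩, rfl⟩

lemma isBounded_triangle {N : ℕ} (A B C : EuclideanSpace ℝ (Fin N)) :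
    Bornology.IsBounded (convexHull ℝ {A, B, C}) :=
  isBounded_convexHull.2 (toFinite _).isBounded

/-- The heart of a triangle lies on the longer-side part of each angle bisector. -/
lemma bisector_bound {N : ℕ} {A B C : EuclideanSpace ℝ (Fin N)} {β γ : ℝ}
    (hP : A + (β • (B - A) + γ • (C - A)) ∈ heart (convexHull ℝ {A, B, C}))
    (hc : 0 < ‖B - A‖) (hcb : ‖B - A‖ ≤ ‖C - A‖) (ha : ‖C - A‖ < ‖B - A - (C - A)‖ + ‖B - A‖) :
    β * ‖B - A‖ ≤ γ * ‖C - A‖ := by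
  have hmem := fun x => mem_convexHull_triple (A := A) (B := B) (C := C) (x := x)
  have hbd := isBounded_triangle A B C
  generalize convexHull ℝ {A, B, C} = K at hP hmem hbd
  generalize B - A = u at *
  generalize C - A = v at *
  have hU : ⟪u, u⟫ = ‖u‖ ^ 2 := real_inner_self_eq_norm_sq u
  have hV : ⟪v, v⟫ = ‖v‖ ^ 2 := real_inner_self_eq_norm_sq v
  have hsub := norm_sub_sq_real u v
  have hG : ⟪v, u⟫ = ⟪u, v⟫ := real_inner_comm _ _
  have hb : 0 < ‖v‖ := hc.trans_le hcb
  have hGlt : ⟪u, v⟫ < ‖u‖ * ‖v‖ := by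
    have : (‖v‖ - ‖u‖) ^ 2 < ‖u - v‖ ^ 2 := by
      have : 0 ≤ ‖v‖ - ‖u‖ := by linarith
      gcongr
      linarith
    linarith
  have hk : 0 < 1 - ⟪u, v⟫ / (‖u‖ * ‖v‖) := by
    rw [sub_pos, div_lt_one (by positivity)]
    exact hGlt
  have hin : ∀ s t : ℝ, ⟪s • u + t • v, ‖u‖⁻¹ • u - ‖v‖⁻¹ • v⟫ =
      (s * ‖u‖ - t * ‖v‖) * (1 - ⟪u, v⟫ / (‖u‖ * ‖v‖)) := fun s t => by
    simp only [inner_add_left, inner_sub_right, real_inner_smul_left, real_inner_smul_right, hU,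
      hV, hG]
    field_simp
    ring
  have hww : ⟪‖u‖⁻¹ • u - ‖v‖⁻¹ • v, ‖u‖⁻¹ • u - ‖v‖⁻¹ • v⟫ =
      2 * (1 - ⟪u, v⟫ / (‖u‖ * ‖v‖)) := by
    have := hin ‖u‖⁻¹ (-‖v‖⁻¹)
    rw [neg_smul, ← sub_eq_add_neg] at this
    rw [this]
    field_simp
    ring
  have hw : ‖u‖⁻¹ • u - ‖v‖⁻¹ • v ≠ 0 := by
    intro h0
    rw [h0, inner_zero_left] at hww
    linarith
  have := inner_sub_nonpos_of_mem_heart hbd hP (Z := A) hw ?_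
  · rw [add_sub_cancel_left, hin] at this
    by_contra! hlt
    have := mul_pos (sub_pos.2 hlt) hk
    linarith
  · intro x hx h0
    obtain ⟨s, t, hs, ht, hst, rfl⟩ := (hmem _).1 hx
    rw [add_sub_cancel_left, hin] at h0 ⊢
    have hst' : t * ‖v‖ ≤ s * ‖u‖ := by
      by_contra! hlt
      have := mul_pos (sub_pos.2 hlt) hk
      linarith
    refine (hmem _).2 ⟨t * ‖v‖ / ‖u‖, s * ‖u‖ / ‖v‖, by positivity, by positivity, ?_, ?_⟩
    · rw [div_add_div _ _ hc.ne' hb.ne']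
      refine le_trans ?_ hst
      rw [div_le_iff₀ (by positivity)]
      nlinarith [mul_nonneg (sub_nonneg.2 hst') (sub_nonneg.2 hcb)]
    · have h2 : 2 * ((s * ‖u‖ - t * ‖v‖) * (1 - ⟪u, v⟫ / (‖u‖ * ‖v‖))) /
          ⟪‖u‖⁻¹ • u - ‖v‖⁻¹ • v, ‖u‖⁻¹ • u - ‖v‖⁻¹ • v⟫ = s * ‖u‖ - t * ‖v‖ := by
        rw [hww, div_eq_iff (mul_pos two_pos hk).ne']
        ring
      rw [h2]
      have e1 : t * ‖v‖ / ‖u‖ = s - (s * ‖u‖ - t * ‖v‖) * ‖u‖⁻¹ := by field_simp; ring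
      have e2 : s * ‖u‖ / ‖v‖ = t + (s * ‖u‖ - t * ‖v‖) * ‖v‖⁻¹ := by field_simp; ring
      rw [e1, e2]
      module

/-- The heart of a triangle lies on the larger-angle part of the perpendicular bisector of its
longest side. -/
lemma perpBisector_bound {N : ℕ} {A B C : EuclideanSpace ℝ (Fin N)} {β γ : ℝ}
    (hP : A + (β • (B - A) + γ • (C - A)) ∈ heart (convexHull ℝ {A, B, C}))
    (hb : 0 < ‖C - A‖) (hca : ‖B - A‖ ≤ ‖B - A - (C - A)‖) :
    β * ⟪B - A, C - A⟫ + (γ - 1 / 2) * ‖C - A‖ ^ 2 ≤ 0 := by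
  have hmem := fun x => mem_convexHull_triple (A := A) (B := B) (C := C) (x := x)
  have hbd := isBounded_triangle A B C
  generalize convexHull ℝ {A, B, C} = K at hP hmem hbd
  generalize B - A = u at *
  generalize C - A = v at *
  have hV : ⟪v, v⟫ = ‖v‖ ^ 2 := real_inner_self_eq_norm_sq v
  have hsub := norm_sub_sq_real u v
  have hsq : ‖u‖ ^ 2 ≤ ‖u - v‖ ^ 2 := by gcongr
  have hin : ∀ s t : ℝ, ⟪A + (s • u + t • v) - (A + (1 / 2 : ℝ) • v), v⟫ =
      s * ⟪u, v⟫ + (t - 1 / 2) * ‖v‖ ^ 2 := fun s t => by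
    simp only [inner_add_left, inner_sub_left, real_inner_smul_left, hV]
    ring
  rw [← hin]
  refine inner_sub_nonpos_of_mem_heart hbd hP (norm_pos_iff.1 hb) ?_
  intro x hx h0
  obtain ⟨s, t, hs, ht, hst, rfl⟩ := (hmem _).1 hx
  rw [hin] at h0 ⊢
  have hV0 : 0 < ‖v‖ ^ 2 := by positivity
  obtain ⟨k, hk⟩ : ∃ k, k = 2 * (s * ⟪u, v⟫ + (t - 1 / 2) * ‖v‖ ^ 2) / ⟪v, v⟫ := ⟨_, rfl⟩
  rw [← hk]
  have hkV : k * ‖v‖ ^ 2 = 2 * (s * ⟪u, v⟫ + (t - 1 / 2) * ‖v‖ ^ 2) := by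
    rw [hk, hV]
    field_simp
  have hk0 : 0 ≤ k := by
    rw [hk, hV]
    positivity
  refine (hmem _).2 ⟨s, t - k, hs, ?_, by linarith, by module⟩
  rw [sub_nonneg]
  refine le_of_mul_le_mul_right ?_ hV0
  have h2 : s * (2 * ⟪u, v⟫) ≤ s * ‖v‖ ^ 2 := mul_le_mul_of_nonneg_left (by linarith) hs
  have h3 : (s + t) * ‖v‖ ^ 2 ≤ 1 * ‖v‖ ^ 2 := by gcongr
  linarith

/-- The planar region, in barycentric coordinates, cut out of a triangle with side ratios
`p ≤ q ≤ 1` by the bisectors at the ends of the longest side and its perpendicular bisector. -/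
lemma volume_bisector_region_lt {p q : ℝ} (hpq : p ≤ q) (h1 : 1 < p + q) (hd : q - p < 1) :
    volume {x : ℝ × ℝ | 0 ≤ x.1 ∧ p * x.1 ≤ x.2 ∧ x.2 ≤ 1 - (1 + q) * x.1 ∧
      x.2 ≤ 1 / 2 - (1 + p ^ 2 - q ^ 2) / 2 * x.1} < ENNReal.ofReal (3 / 16) := by
  have hs : 0 < 1 + p + q := by linarith
  have hd' : 0 < 1 + q - p := by linarith
  obtain ⟨β, hβ⟩ : ∃ β, β = 1 / (1 + p + q) := ⟨_, rfl⟩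
  obtain ⟨η, hη⟩ : ∃ η, η = 1 / ((1 + p + q) * (1 + q - p)) := ⟨_, rfl⟩
  have hη0 : 0 ≤ η := by rw [hη]; positivity
  have hβs : (1 + p + q) * β = 1 := by rw [hβ]; field_simp
  have hηs : (1 + p + q) * (1 + q - p) * η = 1 := by rw [hη]; field_simp
  have hηβ : η ≤ β := by
    rw [hη, hβ]
    apply one_div_le_one_div_of_le hs
    nlinarith
  have hsub : {x : ℝ × ℝ | 0 ≤ x.1 ∧ p * x.1 ≤ x.2 ∧ x.2 ≤ 1 - (1 + q) * x.1 ∧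
      x.2 ≤ 1 / 2 - (1 + p ^ 2 - q ^ 2) / 2 * x.1} ⊆
      {x : ℝ × ℝ | x.1 ∈ Icc 0 η ∧ x.2 ∈ Icc (p * x.1) (1 / 2 - (1 + p ^ 2 - q ^ 2) / 2 * x.1)} ∪
      {x : ℝ × ℝ | x.1 ∈ Icc η β ∧ x.2 ∈ Icc (p * x.1) (1 - (1 + q) * x.1)} := by
    rintro ⟨x, y⟩ ⟨h2, h3, h4, h5⟩
    simp only at h2 h3 h4 h5
    rcases le_total x η with hx | hx
    · exact Or.inl ⟨⟨h2, hx⟩, h3, h5⟩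
    · refine Or.inr ⟨⟨hx, ?_⟩, h3, h4⟩
      refine le_of_mul_le_mul_left ?_ hs
      simp only
      linarith
  refine (measure_mono hsub).trans_lt ((measure_union_le _ _).trans_lt ?_)
  rw [volume_region_Icc (f := fun x => p * x)
      (g := fun x => 1 / 2 - (1 + p ^ 2 - q ^ 2) / 2 * x) (by fun_prop) (by fun_prop) hη0,
    volume_region_Icc (f := fun x => p * x) (g := fun x => 1 - (1 + q) * x) (by fun_prop)
      (by fun_prop) hηβ,
    integral_of_forall_eq_affine (m := 1 / 2) (k := -((1 + p + q) * (1 + p - q) / 2))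
      fun x => by ring,
    integral_of_forall_eq_affine (m := 1) (k := -(1 + p + q)) fun x => by ring,
    ← ENNReal.ofReal_add]
  · apply (ENNReal.ofReal_lt_ofReal_iff (by norm_num)).2
    have : 1 / 2 * (η - 0) + -((1 + p + q) * (1 + p - q) / 2) * (η ^ 2 - 0 ^ 2) / 2 +
        (1 * (β - η) + -(1 + p + q) * (β ^ 2 - η ^ 2) / 2) =
        (1 + 2 * (q - p)) / (4 * ((1 + p + q) * (1 + q - p))) := by
      rw [hη, hβ]
      field_simp
      ring
    rw [this, div_lt_div_iff₀ (by positivity) (by norm_num)]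
    nlinarith
  · have : 1 / 2 * (η - 0) + -((1 + p + q) * (1 + p - q) / 2) * (η ^ 2 - 0 ^ 2) / 2 =
        (1 + 3 * (q - p)) / (4 * (1 + p + q) * (1 + q - p) ^ 2) := by
      rw [hη]
      field_simp
      ring
    rw [this]
    have : 0 ≤ q - p := by linarith
    positivity
  · have : 1 * (β - η) + -(1 + p + q) * (β ^ 2 - η ^ 2) / 2 =
        (q - p) ^ 2 / (2 * (1 + p + q) * (1 + q - p) ^ 2) := by
      rw [hη, hβ]
      field_simp
      ring
    rw [this]
    positivity
  · rintro x ⟨hx0, hx⟩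
    have := mul_le_mul_of_nonneg_left hx hs.le
    linarith
  · rintro x ⟨hx0, hx⟩
    have e1 : (1 + p + q) * (1 + p - q) * x ≤ (1 + p + q) * (1 + p - q) * η :=
      mul_le_mul_of_nonneg_left hx (mul_nonneg hs.le (by linarith))
    have e2 : 0 ≤ (1 + p + q) * η * (q - p) :=
      mul_nonneg (mul_nonneg hs.le hη0) (by linarith)
    linarith

lemma combMap_injective {E : Type*} [NormedAddCommGroup E] [InnerProductSpace ℝ E] {u v : E}
    (h : ⟪u, v⟫ ^ 2 < ‖u‖ ^ 2 * ‖v‖ ^ 2) : Function.Injective (combMap u v) := by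
  rw [← LinearMap.ker_eq_bot, LinearMap.ker_eq_bot']
  rintro ⟨s, t⟩ h0
  rw [combMap_apply] at h0
  simp only at h0
  have h1 : s * ‖u‖ ^ 2 + t * ⟪u, v⟫ = 0 := by
    have := congrArg (fun x => ⟪u, x⟫) h0
    simpa only [inner_add_right, real_inner_smul_right, real_inner_self_eq_norm_sq,
      inner_zero_right] using this
  have h2 : s * ⟪u, v⟫ + t * ‖v‖ ^ 2 = 0 := by
    have := congrArg (fun x => ⟪x, v⟫) h0
    simpa only [inner_add_left, real_inner_smul_left, real_inner_self_eq_norm_sq,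
      inner_zero_left] using this
  have hd := (sub_pos.2 h).ne'
  have hs : s * (‖u‖ ^ 2 * ‖v‖ ^ 2 - ⟪u, v⟫ ^ 2) = 0 := by
    linear_combination ‖v‖ ^ 2 * h1 - ⟪u, v⟫ * h2
  have ht : t * (‖u‖ ^ 2 * ‖v‖ ^ 2 - ⟪u, v⟫ ^ 2) = 0 := by
    linear_combination ‖u‖ ^ 2 * h2 - ⟪u, v⟫ * h1
  simp [(mul_eq_zero.1 hs).resolve_right hd, (mul_eq_zero.1 ht).resolve_right hd]

lemma volume_heart_lt_of_sorted {A B C : EuclideanSpace ℝ (Fin 2)}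
    (hcol : ¬ Collinear ℝ {A, B, C}) (hca : dist A B ≤ dist B C) (hab : dist B C ≤ dist A C) :
    volume (heart (convexHull ℝ {A, B, C})) < 3 / 8 * volume (convexHull ℝ {A, B, C}) := by
  have htri : dist A C < dist A B + dist B C :=
    lt_of_le_of_ne (dist_triangle A B C) fun h =>
      hcol (dist_add_dist_eq_iff.1 h.symm).collinear
  have hc0 : 0 < dist A B := by linarith
  have ha0 : 0 < dist B C := by linarith
  have hb0 : 0 < dist A C := by linarith
  have ec : ‖B - A‖ = dist A B := (dist_eq_norm' A B).symm
  have eb : ‖C - A‖ = dist A C := (dist_eq_norm' A C).symm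
  have ea : ‖B - A - (C - A)‖ = dist B C := by rw [sub_sub_sub_cancel_right, dist_eq_norm]
  have hG := norm_sub_sq_real (B - A) (C - A)
  rw [ea, eb, ec] at hG
  have hinj : Function.Injective (combMap (B - A) (C - A)) := by
    apply combMap_injective
    rw [eb, ec]
    have : 0 < (dist A B + dist B C + dist A C) * (dist A B + dist B C - dist A C) *
        (dist A B + (dist A C - dist B C)) * (dist A C + (dist B C - dist A B)) := by
      have h1 : 0 < dist A B + dist B C - dist A C := by linarith
      have h2 : 0 < dist A B + (dist A C - dist B C) := by linarith
      have h3 : 0 < dist A C + (dist B C - dist A B) := by linarith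
      positivity
    have hG' : ⟪B - A, C - A⟫ = (dist A B ^ 2 + dist A C ^ 2 - dist B C ^ 2) / 2 := by linarith
    rw [hG']
    linarith
  obtain ⟨D, hD0, hD, hvol⟩ := exists_volume_image_affine A _ hinj
  have hK : volume (convexHull ℝ {A, B, C}) = D * ENNReal.ofReal (1 / 2) := by
    rw [convexHull_triple_eq_image, hvol, volume_stdTriangle]
  have hsub : heart (convexHull ℝ {A, B, C}) ⊆ (fun x => A + combMap (B - A) (C - A) x) ''
      {x : ℝ × ℝ | 0 ≤ x.1 ∧ dist A B / dist A C * x.1 ≤ x.2 ∧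
        x.2 ≤ 1 - (1 + dist B C / dist A C) * x.1 ∧
        x.2 ≤ 1 / 2 - (1 + (dist A B / dist A C) ^ 2 - (dist B C / dist A C) ^ 2) / 2 * x.1} := by
    intro P hP
    obtain ⟨β, γ, hβ, hγ, hβγ, rfl⟩ := mem_convexHull_triple.1 hP.1
    refine ⟨(β, γ), ⟨hβ, ?_, ?_, ?_⟩, rfl⟩
    · have := bisector_bound hP (by linarith) (by linarith) (by linarith)
      rw [ec, eb] at this
      simp only
      rw [div_mul_eq_mul_div, div_le_iff₀ hb0]
      linarith
    · have hset : ({A, B, C} : Set (EuclideanSpace ℝ (Fin 2))) = {C, B, A} := by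
        ext x; simp only [mem_insert_iff, mem_singleton_iff]; tauto
      have hP' : C + (β • (B - C) + (1 - β - γ) • (A - C)) ∈ heart (convexHull ℝ {C, B, A}) := by
        rw [← hset]
        convert hP using 1
        module
      have e1 : ‖B - C‖ = dist B C := (dist_eq_norm B C).symm
      have e2 : ‖A - C‖ = dist A C := (dist_eq_norm A C).symm
      have e3 : ‖B - C - (A - C)‖ = dist A B := by
        rw [sub_sub_sub_cancel_right, dist_eq_norm']
      have := bisector_bound hP' (by linarith) (by linarith) (by linarith)
      rw [e1, e2] at this
      simp only
      have h2 : dist B C / dist A C * β ≤ 1 - β - γ := by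
        rw [div_mul_eq_mul_div, div_le_iff₀ hb0]
        linarith
      linarith
    · have := perpBisector_bound hP (by linarith) (by linarith)
      rw [eb] at this
      simp only
      refine le_of_mul_le_mul_right ?_ (pow_pos hb0 2)
      have h2 : (1 / 2 - (1 + (dist A B / dist A C) ^ 2 - (dist B C / dist A C) ^ 2) / 2 * β) *
          dist A C ^ 2 = dist A C ^ 2 / 2 -
            (dist A C ^ 2 + dist A B ^ 2 - dist B C ^ 2) / 2 * β := by
        field_simp
      rw [h2, hG]
      linarith
  have hlt := volume_bisector_region_lt (p := dist A B / dist A C) (q := dist B C / dist A C)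
    (by gcongr) (by rw [← add_div, lt_div_iff₀ hb0]; linarith)
    (by rw [← sub_div, div_lt_iff₀ hb0]; linarith)
  calc _ ≤ _ := measure_mono hsub
    _ = _ := hvol _
    _ < D * ENNReal.ofReal (3 / 16) := ENNReal.mul_lt_mul_right hD0 hD hlt
    _ = _ := by
      rw [hK, mul_left_comm]
      congr 1
      have : (3 / 8 : ℝ≥0∞) = ENNReal.ofReal (3 / 8) := by
        rw [ENNReal.ofReal_div_of_pos (by norm_num)]
        norm_num
      rw [this, ← ENNReal.ofReal_mul (by norm_num)]
      norm_num

lemma volume_heart_lt {A B C : EuclideanSpace ℝ (Fin 2)} (hcol : ¬ Collinear ℝ {A, B, C}) :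
    volume (heart (convexHull ℝ {A, B, C})) < 3 / 8 * volume (convexHull ℝ {A, B, C}) := by
  have key : ∀ X Y Z : EuclideanSpace ℝ (Fin 2), ({X, Y, Z} : Set _) = {A, B, C} →
      dist X Y ≤ dist Y Z → dist Y Z ≤ dist X Z →
      volume (heart (convexHull ℝ {A, B, C})) < 3 / 8 * volume (convexHull ℝ {A, B, C}) := by
    intro X Y Z h h1 h2
    rw [← h] at hcol ⊢
    exact volume_heart_lt_of_sorted hcol h1 h2
  have hset : ∀ X Y Z : EuclideanSpace ℝ (Fin 2), (∀ x, x = X ∨ x = Y ∨ x = Z ↔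
      x = A ∨ x = B ∨ x = C) → ({X, Y, Z} : Set _) = {A, B, C} := fun X Y Z h => Set.ext h
  have e1 := dist_comm A B
  have e2 := dist_comm B C
  have e3 := dist_comm A C
  rcases le_total (dist A B) (dist B C) with h1 | h1 <;>
  rcases le_total (dist B C) (dist A C) with h2 | h2 <;>
  rcases le_total (dist A B) (dist A C) with h3 | h3
  · exact key A B C rfl h1 h2
  · exact key A B C rfl h1 h2
  · exact key B A C (hset _ _ _ fun x => by tauto) (by linarith) (by linarith)
  · exact key C A B (hset _ _ _ fun x => by tauto) (by linarith) (by linarith)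
  · exact key C B A (hset _ _ _ fun x => by tauto) (by linarith) (by linarith)
  · exact key B C A (hset _ _ _ fun x => by tauto) (by linarith) (by linarith)
  · exact key C B A (hset _ _ _ fun x => by tauto) (by linarith) (by linarith)
  · exact key A C B (hset _ _ _ fun x => by tauto) (by linarith) (by linarith)

lemma mem_convexHull_flat_iff {b h : ℝ} (hh : 0 < h) (x : EuclideanSpace ℝ (Fin 2)) :
    x ∈ convexHull ℝ {0, !₂[b, h], !₂[1, 0]} ↔ MemTriangle b h (x 0) (x 1) := by
  rw [mem_convexHull_triple]
  constructor
  · rintro ⟨β, γ, hβ, hγ, hβγ, rfl⟩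
    have h1 := mul_nonneg hh.le hγ
    have h2 := mul_le_mul_of_nonneg_left hβγ hh.le
    simp only [MemTriangle, sub_zero, zero_add, PiLp.add_apply, PiLp.smul_apply, smul_eq_mul,
      Matrix.cons_val]
    exact ⟨by positivity, by linarith, by linarith⟩
  · rintro ⟨h1, h2, h3⟩
    refine ⟨x 1 / h, x 0 - b * x 1 / h, by positivity, ?_, ?_, ?_⟩
    · rw [sub_nonneg, div_le_iff₀ hh]
      linarith
    · refine le_of_mul_le_mul_left ?_ hh
      have : h * (x 1 / h + (x 0 - b * x 1 / h)) = x 1 + (h * x 0 - b * x 1) := by field_simp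
      linarith
    · ext i
      fin_cases i
      · simp only [Fin.zero_eta, sub_zero, zero_add, PiLp.add_apply, PiLp.smul_apply, smul_eq_mul,
          Matrix.cons_val]
        ring
      · simp only [Fin.mk_one, sub_zero, zero_add, PiLp.add_apply, PiLp.smul_apply, smul_eq_mul,
          Matrix.cons_val]
        field_simp
        ring

lemma mem_heart_flat {b h : ℝ} (hb : 0 < b) (hb' : b ≤ 1 / 10) (hh : 0 < h) (hhb : h ≤ b ^ 2)
    {P : EuclideanSpace ℝ (Fin 2)} (hx : 2 * b ≤ P 0) (hx' : P 0 ≤ 1 / 2) (hy : 0 ≤ P 1)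
    (hy' : 2 * P 1 ≤ h * (1 - b) * (1 - P 0)) :
    P ∈ heart (convexHull ℝ {0, !₂[b, h], !₂[1, 0]}) := by
  have hin : ∀ x y : EuclideanSpace ℝ (Fin 2), ⟪x, y⟫ = x 0 * y 0 + x 1 * y 1 := fun x y => by
    simp [PiLp.inner_apply, Fin.sum_univ_two, mul_comm]
  have hx1 : 0 ≤ h * (1 - P 0) := mul_nonneg hh.le (by linarith)
  refine mem_heart_of_forall (isBounded_triangle _ _ _) ?_ ?_
  · rw [mem_convexHull_flat_iff hh]
    have h1 : 0 ≤ b * (h * (1 - P 0)) := mul_nonneg hb.le hx1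
    have h2 : 0 ≤ b * P 1 := mul_nonneg hb.le hy
    have h3 : h * (2 * b) ≤ h * P 0 := mul_le_mul_of_nonneg_left hx hh.le
    have h4 : b * (2 * P 1) ≤ b * (h * (1 - b) * (1 - P 0)) := mul_le_mul_of_nonneg_left hy' hb.le
    have h5 : b * h * ((1 - b) * (1 - P 0)) ≤ b * h * 1 :=
      mul_le_mul_of_nonneg_left (by nlinarith) (by positivity)
    have h6 := mul_pos hb hh
    exact ⟨hy, by linarith, by linarith⟩
  · intro ω hω l hl H
    have hω' : ω 0 ^ 2 + ω 1 ^ 2 = 1 := by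
      have := real_inner_self_eq_norm_sq ω
      rw [hω, hin] at this
      linarith
    rw [hin] at hl
    refine not_fold_memTriangle hb hb' hh hhb hx hx' hy hy' hω' hl fun p q hpq hlpq => ?_
    have := H !₂[p, q] ((mem_convexHull_flat_iff hh _).2 (by simpa using hpq))
      (by simpa [hin] using hlpq)
    rw [mem_convexHull_flat_iff hh] at this
    simpa [reflectH, hin] using this

lemma not_collinear_flat {b h : ℝ} (hh : 0 < h) :
    ¬ Collinear ℝ ({0, !₂[b, h], !₂[1, 0]} : Set (EuclideanSpace ℝ (Fin 2))) := by
  intro hc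
  obtain ⟨v, hv⟩ := (collinear_iff_of_mem (p₀ := 0) (by simp)).1 hc
  obtain ⟨r, hr⟩ := hv !₂[b, h] (by simp)
  obtain ⟨s, hs⟩ := hv !₂[1, 0] (by simp)
  have h1 : h = r * v 1 := by simpa using congrArg (fun x => x 1) hr
  have h2 : 1 = s * v 0 := by simpa using congrArg (fun x => x 0) hs
  have h3 : 0 = s * v 1 := by simpa using congrArg (fun x => x 1) hs
  have hs0 : s ≠ 0 := by
    rintro rfl
    simp at h2
  have hv1 : v 1 = 0 := (mul_eq_zero.1 h3.symm).resolve_left hs0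
  rw [hv1, mul_zero] at h1
  exact hh.ne' h1

/-- The heart of a flat triangle fills almost `3 / 8` of the triangle. -/
lemma le_volume_heart_flat_div {b h : ℝ} (hb : 0 < b) (hb' : b ≤ 1 / 10) (hh : 0 < h)
    (hhb : h ≤ b ^ 2) :
    3 / 8 - 3 * b ≤
      (volume (heart (convexHull ℝ ({0, !₂[b, h], !₂[1, 0]} :
        Set (EuclideanSpace ℝ (Fin 2)))))).toReal /
      (volume (convexHull ℝ ({0, !₂[b, h], !₂[1, 0]} :
        Set (EuclideanSpace ℝ (Fin 2))))).toReal := by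
  let u : EuclideanSpace ℝ (Fin 2) := !₂[0, h]
  let v : EuclideanSpace ℝ (Fin 2) := !₂[1, 0]
  have hcomb0 : ∀ p, (0 + combMap u v p) 0 = p.2 := fun p => by simp [u, v, combMap_apply]
  have hcomb1 : ∀ p, (0 + combMap u v p) 1 = h * p.1 := fun p => by
    simp [u, v, combMap_apply, mul_comm]
  have hinj : Function.Injective (combMap u v) := by
    intro p q hpq
    have h0 := hcomb0 p
    have h1 := hcomb1 p
    rw [hpq, hcomb0] at h0
    rw [hpq, hcomb1] at h1
    exact Prod.ext (mul_left_cancel₀ hh.ne' h1).symm h0.symm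
  obtain ⟨D, hD0, hD, hvol⟩ := exists_volume_image_affine 0 _ hinj
  have hK : convexHull ℝ ({0, !₂[b, h], !₂[1, 0]} : Set (EuclideanSpace ℝ (Fin 2))) =
      (fun p => 0 + combMap u v p) ''
        {p : ℝ × ℝ | p.1 ∈ Icc 0 1 ∧ p.2 ∈ Icc (b * p.1) (1 - (1 - b) * p.1)} := by
    ext x
    rw [mem_convexHull_flat_iff hh]
    constructor
    · rintro ⟨h1, h2, h3⟩
      have h4 : x 1 ≤ h := by linarith
      refine ⟨(x 1 / h, x 0), ⟨⟨by positivity, ?_⟩, ?_, ?_⟩, ?_⟩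
      · simp only
        rwa [div_le_one hh]
      · simp only
        rw [mul_div_assoc', div_le_iff₀ hh]
        linarith
      · simp only
        rw [mul_div_assoc', le_sub_iff_add_le, ← le_sub_iff_add_le', div_le_iff₀ hh]
        linarith
      · ext i
        fin_cases i
        · exact hcomb0 _
        · exact (hcomb1 _).trans (mul_div_cancel₀ _ hh.ne')
    · rintro ⟨⟨β, x⟩, ⟨⟨h1, -⟩, h2, h3⟩, rfl⟩
      simp only at h1 h2 h3 ⊢
      rw [hcomb0, hcomb1]
      have h4 := mul_le_mul_of_nonneg_left h2 hh.le
      have h5 := mul_le_mul_of_nonneg_left h3 hh.le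
      exact ⟨by positivity, by linarith, by linarith⟩
  have hQ : (fun p => 0 + combMap u v p) ''
      {p : ℝ × ℝ | p.2 ∈ Icc (2 * b) (1 / 2) ∧ p.1 ∈ Icc 0 ((1 - b) * (1 - p.2) / 2)} ⊆
      heart (convexHull ℝ {0, !₂[b, h], !₂[1, 0]}) := by
    rintro _ ⟨⟨β, x⟩, ⟨⟨h1, h2⟩, h3, h4⟩, rfl⟩
    simp only at h1 h2 h3 h4 ⊢
    have h5 := mul_le_mul_of_nonneg_left h4 hh.le
    apply mem_heart_flat hb hb' hh hhb <;> simp only [hcomb0, hcomb1] <;> first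
      | linarith
      | positivity
  have hKvol : volume (convexHull ℝ ({0, !₂[b, h], !₂[1, 0]} : Set (EuclideanSpace ℝ (Fin 2)))) =
      D * ENNReal.ofReal (1 / 2) := by
    rw [hK, hvol, volume_region_Icc (f := fun x => b * x) (g := fun x => 1 - (1 - b) * x)
      (by fun_prop) (by fun_prop) zero_le_one (fun x hx => by linarith [hx.2]),
      integral_of_forall_eq_affine (m := 1) (k := -1) fun x => by ring]
    norm_num
  have hQvol : D * ENNReal.ofReal ((1 - b) * ((1 - 2 * b) ^ 2 - 1 / 4) / 4) ≤
      volume (heart (convexHull ℝ ({0, !₂[b, h], !₂[1, 0]} :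
        Set (EuclideanSpace ℝ (Fin 2))))) := by
    refine le_trans (le_of_eq ?_) (measure_mono hQ)
    rw [hvol, volume_region_Icc_swap (f := fun _ => 0) (g := fun x => (1 - b) * (1 - x) / 2)
      (by fun_prop) (by fun_prop) (by linarith)
      (fun x hx => div_nonneg (mul_nonneg (by linarith) (by linarith [hx.2])) zero_le_two),
      integral_of_forall_eq_affine (m := (1 - b) / 2) (k := -((1 - b) / 2)) fun x => by ring]
    congr 2
    ring
  have hKfin : volume (convexHull ℝ ({0, !₂[b, h], !₂[1, 0]} :
      Set (EuclideanSpace ℝ (Fin 2)))) ≠ ⊤ := by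
    rw [hKvol]
    exact ENNReal.mul_ne_top hD ENNReal.ofReal_ne_top
  have hle := ENNReal.toReal_mono (measure_ne_top_of_subset (fun x hx => hx.1) hKfin) hQvol
  have hq0 : 0 ≤ (1 - b) * ((1 - 2 * b) ^ 2 - 1 / 4) / 4 := by
    have h1 : 0 ≤ 1 - b := by linarith
    have h2 : 0 ≤ (1 - 2 * b) ^ 2 - 1 / 4 := by nlinarith
    positivity
  have hDpos := ENNReal.toReal_pos hD0 hD
  rw [ENNReal.toReal_mul, ENNReal.toReal_ofReal hq0] at hle
  rw [hKvol, ENNReal.toReal_mul, ENNReal.toReal_ofReal (by norm_num), le_div_iff₀ (by positivity)]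
  refine le_trans ?_ hle
  have : (3 / 8 - 3 * b) * (1 / 2) ≤ (1 - b) * ((1 - 2 * b) ^ 2 - 1 / 4) / 4 := by
    nlinarith [mul_pos hb hb, mul_pos hb (mul_pos hb hb)]
  nlinarith

/-- The supremum of `|♥(K)|/|K|` over all (nondegenerate) triangles `K ⊂ ℝ²` equals
`3/8`, and it is not attained: every triangle satisfies the strict inequality
`|♥(K)| < (3/8)|K|`. -/
theorem statement19 :
    IsLUB {ρ : ℝ | ∃ A B C : EuclideanSpace ℝ (Fin 2), AffineIndependent ℝ ![A, B, C] ∧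
        ρ = (volume (heart (convexHull ℝ ({A, B, C} : Set (EuclideanSpace ℝ (Fin 2)))))).toReal /
            (volume (convexHull ℝ ({A, B, C} : Set (EuclideanSpace ℝ (Fin 2))))).toReal}
      (3 / 8) ∧
    ∀ A B C : EuclideanSpace ℝ (Fin 2), AffineIndependent ℝ ![A, B, C] →
      volume (heart (convexHull ℝ ({A, B, C} : Set (EuclideanSpace ℝ (Fin 2))))) <
        (3 / 8 : ℝ≥0∞) * volume (convexHull ℝ ({A, B, C} : Set (EuclideanSpace ℝ (Fin 2)))) := by
  have hlt : ∀ A B C : EuclideanSpace ℝ (Fin 2), AffineIndependent ℝ ![A, B, C] →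
      volume (heart (convexHull ℝ ({A, B, C} : Set (EuclideanSpace ℝ (Fin 2))))) <
        (3 / 8 : ℝ≥0∞) * volume (convexHull ℝ ({A, B, C} : Set (EuclideanSpace ℝ (Fin 2)))) :=
    fun A B C h => volume_heart_lt (affineIndependent_iff_not_collinear_set.1 h)
  refine ⟨⟨?_, fun M hM => ?_⟩, hlt⟩
  · rintro _ ⟨A, B, C, h, rfl⟩
    have hfin : volume (convexHull ℝ ({A, B, C} : Set (EuclideanSpace ℝ (Fin 2)))) ≠ ⊤ :=
      (isBounded_triangle A B C).measure_lt_top.ne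
    refine div_le_of_le_mul₀ ENNReal.toReal_nonneg (by norm_num) ?_
    have := ENNReal.toReal_mono
      (ENNReal.mul_ne_top (ENNReal.div_ne_top (by simp) (by simp)) hfin) (hlt A B C h).le
    simpa [ENNReal.toReal_mul, ENNReal.toReal_div] using this
  · by_contra! hlt'
    obtain ⟨b, hb, hb', hbM⟩ : ∃ b : ℝ, 0 < b ∧ b ≤ 1 / 10 ∧ 3 * b < 3 / 8 - M := by
      refine ⟨min (1 / 10) ((3 / 8 - M) / 6), by
        apply lt_min <;> linarith, min_le_left _ _, ?_⟩
      linarith [min_le_right (1 / 10) ((3 / 8 - M) / 6)]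
    have hh : 0 < b ^ 2 := by positivity
    have h1 := hM ⟨0, !₂[b, b ^ 2], !₂[1, 0],
      affineIndependent_iff_not_collinear_set.2 (not_collinear_flat hh), rfl⟩
    linarith [le_volume_heart_flat_div hb hb' hh le_rfl]
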